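/- Let a_0,…,a_n be positive integers, F(z) = Σ_{j=0}^n |z_j|², G(z) = Σ_{j=0}^n z_j^{a_j}, G_1 = Re G, G_2 = Im G, and B = {z : F(z) = 1, G(z) = 0}. For z ∈ B, define the subspace H_N(z) = { v ∈ ℂ^{n+1} : α_z(v) = 0, (dF)_z(v) = 0, (dG_1)_z(v) = 0, (dG_2)_z(v) = 0 }, where α_z(v) = (1/4)·Σ_j a_j·Im(conj(z_j)·v_j). Then the restriction of ω_a(u,v) = (1/2)·Σ_j a_j·Im(conj(u_j)·v_j) to H_N(z) is nondegenerate: for every nonzero v ∈ H_N(z) there exists w ∈ H_N(z) with ω_a(v,w) ≠ 0. Hence the Brieskorn manifold (B, α) is a co-oriented contact submanifold of (S^{2n+1}, α). -/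

import Mathlib

open Finset ComplexConjugate

/-- `F(z) = Σ_j |z_j|²`. -/
noncomputable def sphF {N : ℕ} (z : Fin N → ℂ) : ℝ := ∑ j, Complex.normSq (z j)

/-- The contact form `α_z(v) = (1/4)·Σ_j a_j·Im(conj(z_j)·v_j)`. -/
noncomputable def sphAlpha {N : ℕ} (a : Fin N → ℝ) (z v : Fin N → ℂ) : ℝ :=
  (1/4) * ∑ j, a j * (conj (z j) * v j).im

/-- The 2-form `ω_a(u,v) = (1/2)·Σ_j a_j·Im(conj(u_j)·v_j)`. -/
noncomputable def sphOmega {N : ℕ} (a : Fin N → ℝ) (u v : Fin N → ℂ) : ℝ :=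
  (1/2) * ∑ j, a j * (conj (u j) * v j).im

/-- The Brieskorn polynomial `G(z) = Σ_j z_j^{a_j}`. -/
noncomputable def brG {N : ℕ} (a : Fin N → ℕ) (z : Fin N → ℂ) : ℂ :=
  ∑ j, z j ^ a j

/-- The Hermitian form `h_a(u,v) = Σ_j a_j·conj(u_j)·v_j`, whose imaginary part is `2·ω_a`. -/
noncomputable def weightedHerm {N : ℕ} (a : Fin N → ℝ) (u v : Fin N → ℂ) : ℂ :=
  ∑ j, (a j : ℂ) * (conj (u j) * v j)

section weightedHerm

variable {N : ℕ} (a : Fin N → ℝ) (u v w : Fin N → ℂ)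

lemma weightedHerm_add_right :
    weightedHerm a u (v + w) = weightedHerm a u v + weightedHerm a u w := by
  simp only [weightedHerm, Pi.add_apply, mul_add, sum_add_distrib]

lemma weightedHerm_smul_right (c : ℂ) :
    weightedHerm a u (c • v) = c * weightedHerm a u v := by
  simp only [weightedHerm, Pi.smul_apply, smul_eq_mul, mul_sum]
  exact sum_congr rfl fun j _ => by ring

lemma conj_weightedHerm : conj (weightedHerm a u v) = weightedHerm a v u := by
  simp only [weightedHerm, map_sum, map_mul, Complex.conj_conj, Complex.conj_ofReal]
  exact sum_congr rfl fun j _ => by ring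

lemma weightedHerm_self :
    weightedHerm a v v = ((∑ j, a j * Complex.normSq (v j) : ℝ) : ℂ) := by
  simp only [weightedHerm, ← Complex.normSq_eq_conj_mul_self]
  push_cast
  rfl

variable {a v} in
lemma sum_mul_normSq_pos (ha : ∀ j, 0 < a j) (hv : v ≠ 0) :
    0 < ∑ j, a j * Complex.normSq (v j) := by
  obtain ⟨j, hj⟩ := Function.ne_iff.mp hv
  exact sum_pos' (fun i _ => mul_nonneg (ha i).le (Complex.normSq_nonneg _))
    ⟨j, mem_univ j, mul_pos (ha j) (Complex.normSq_pos.mpr hj)⟩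

lemma sphOmega_eq_im_weightedHerm : sphOmega a u v = (1/2) * (weightedHerm a u v).im := by
  simp [sphOmega, weightedHerm, Complex.im_sum]

lemma sphAlpha_eq_im_weightedHerm : sphAlpha a u v = (1/4) * (weightedHerm a u v).im := by
  simp [sphAlpha, weightedHerm, Complex.im_sum]

end weightedHerm

/-- A vector `v` which is `Im h_a`-orthogonal to `z` and `x` and `h_a`-orthogonal to `y` pairs
nontrivially under `Im h_a` with another such vector, namely with a correction of `i·v` by a
combination of `z`, `x` and `y`. -/
lemma exists_im_weightedHerm_ne_zero {N : ℕ} {a : Fin N → ℝ} (ha : ∀ j, 0 < a j)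
    {x y z v : Fin N → ℂ} (hxz : weightedHerm a x z = -Complex.I) (hyx : weightedHerm a y x = 0)
    (hy : y ≠ 0) (hv : v ≠ 0) (hzv : (weightedHerm a z v).im = 0)
    (hxv : (weightedHerm a x v).im = 0) (hyv : weightedHerm a y v = 0) :
    ∃ w, (weightedHerm a z w).im = 0 ∧ (weightedHerm a x w).im = 0 ∧
      weightedHerm a y w = 0 ∧ (weightedHerm a v w).im ≠ 0 := by
  have hyy : weightedHerm a y y ≠ 0 := by
    rw [weightedHerm_self]
    exact_mod_cast (sum_mul_normSq_pos ha hy).ne'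
  have hzx : weightedHerm a z x = Complex.I := by
    rw [← conj_weightedHerm, hxz]; simp
  have hxy : weightedHerm a x y = 0 := by
    rw [← conj_weightedHerm, hyx, map_zero]
  have hvz : (weightedHerm a v z).im = 0 := by
    rw [← conj_weightedHerm, Complex.conj_im, hzv, neg_zero]
  have hvx : (weightedHerm a v x).im = 0 := by
    rw [← conj_weightedHerm, Complex.conj_im, hxv, neg_zero]
  have hvy : weightedHerm a v y = 0 := by
    rw [← conj_weightedHerm, hyv, map_zero]
  obtain ⟨p, hp⟩ : ∃ p : ℝ, p = (weightedHerm a x v).re := ⟨_, rfl⟩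
  obtain ⟨m, hm⟩ : ∃ m : ℂ, p * weightedHerm a y z + m * weightedHerm a y y = 0 :=
    ⟨-(p * weightedHerm a y z) / weightedHerm a y y, by rw [div_mul_cancel₀ _ hyy]; ring⟩
  obtain ⟨q, hq⟩ : ∃ q : ℝ,
      (weightedHerm a z v).re + q + (m * weightedHerm a z y).im = 0 :=
    ⟨-(weightedHerm a z v).re - (m * weightedHerm a z y).im, by ring⟩
  refine ⟨Complex.I • v + (p : ℂ) • z + (q : ℂ) • x + m • y, ?_, ?_, ?_, ?_⟩ <;>
    simp only [weightedHerm_add_right, weightedHerm_smul_right]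
  · rw [hzx, weightedHerm_self a z]
    simp only [Complex.add_im, Complex.I_mul_im, Complex.im_ofReal_mul, Complex.ofReal_im,
      Complex.I_im]
    linarith
  · rw [hxz, hxy]
    rw [weightedHerm_self a x]
    simp [hp]
  · rw [hyv, hyx]
    linear_combination hm
  · rw [hvy, weightedHerm_self a v]
    simp only [Complex.add_im, Complex.I_mul_im, Complex.im_ofReal_mul, Complex.ofReal_re, hvz,
      hvx]
    simpa using (sum_mul_normSq_pos ha hv).ne'

lemma fderiv_sphF_apply {N : ℕ} (z v : Fin N → ℂ) :
    fderiv ℝ sphF z v = 2 * (∑ j, conj (z j) * v j).re := by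
  have h : HasFDerivAt (𝕜 := ℝ) sphF
      (∑ j, 2 • (innerSL ℝ (z j)).comp (ContinuousLinearMap.proj (R := ℝ) j)) z := by
    have := HasFDerivAt.fun_sum (u := univ) fun j _ =>
      (ContinuousLinearMap.proj (R := ℝ) (φ := fun _ : Fin N => ℂ) j).hasFDerivAt (x := z) |>.norm_sq
    simp only [← Complex.normSq_eq_norm_sq] at this
    exact this
  rw [h.fderiv]
  simp [Complex.re_sum, mul_sum, Complex.inner]
  exact sum_congr rfl fun j _ => by ring

/-- The real derivative of `G` is the complex-linear map `v ↦ Σ_j a_j·z_j^{a_j-1}·v_j`. -/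
lemma hasFDerivAt_brG {N : ℕ} (a : Fin N → ℕ) (z : Fin N → ℂ) :
    HasFDerivAt (𝕜 := ℝ) (brG a)
      (∑ j, (a j * z j ^ (a j - 1)) • ContinuousLinearMap.proj (R := ℝ) (φ := fun _ : Fin N => ℂ) j)
      z := by
  refine HasFDerivAt.fun_sum fun j _ => ?_
  have := (ContinuousLinearMap.proj (R := ℝ) (φ := fun _ : Fin N => ℂ) j).hasFDerivAt
    (x := z) |>.pow (a j)
  exact this.congr_fderiv (by simp)

lemma fderiv_re_brG_apply {N : ℕ} (a : Fin N → ℕ) (z v : Fin N → ℂ) :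
    fderiv ℝ (fun w => (brG a w).re) z v = (∑ j, a j * z j ^ (a j - 1) * v j).re := by
  have h : HasFDerivAt (fun w => (brG a w).re) _ z :=
    Complex.reCLM.hasFDerivAt.comp z (hasFDerivAt_brG a z)
  rw [h.fderiv]
  simp

lemma fderiv_im_brG_apply {N : ℕ} (a : Fin N → ℕ) (z v : Fin N → ℂ) :
    fderiv ℝ (fun w => (brG a w).im) z v = (∑ j, a j * z j ^ (a j - 1) * v j).im := by
  have h : HasFDerivAt (fun w => (brG a w).im) _ z :=
    Complex.imCLM.hasFDerivAt.comp z (hasFDerivAt_brG a z)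
  rw [h.fderiv]
  simp

/-- At every point `z` of the Brieskorn manifold
`B = {F = 1, G = 0}`, the restriction of `ω_a` to the subspace
`H_N(z) = {v : α_z(v) = 0, dF_z(v) = 0, dG₁_z(v) = 0, dG₂_z(v) = 0}` is
nondegenerate; hence `(B, α)` is a co-oriented contact submanifold of
`(S^{2n+1}, α)`. -/
theorem brieskorn_contact_submanifold
    (n : ℕ) (a : Fin (n+1) → ℕ) (ha : ∀ j, 0 < a j)
    (z : Fin (n+1) → ℂ) (hz1 : sphF z = 1) (hz2 : brG a z = 0)
    (HN : Set (Fin (n+1) → ℂ))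
    (hHN : ∀ v, v ∈ HN ↔
      sphAlpha (fun j => (a j : ℝ)) z v = 0 ∧
      fderiv ℝ sphF z v = 0 ∧
      fderiv ℝ (fun w => (brG a w).re) z v = 0 ∧
      fderiv ℝ (fun w => (brG a w).im) z v = 0) :
    ∀ v ∈ HN, v ≠ 0 → ∃ w ∈ HN, sphOmega (fun j => (a j : ℝ)) v w ≠ 0 := by
  have ha' : ∀ j, 0 < (a j : ℝ) := fun j => Nat.cast_pos.mpr (ha j)
  have hac : ∀ j, (a j : ℂ) ≠ 0 := fun j => Nat.cast_ne_zero.mpr (ha j).ne'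
  let x : Fin (n+1) → ℂ := fun j => Complex.I * z j / a j
  let y : Fin (n+1) → ℂ := fun j => conj (z j) ^ (a j - 1)
  have hx : ∀ v, weightedHerm (fun j => (a j : ℝ)) x v =
      -Complex.I * ∑ j, conj (z j) * v j := fun v => by
    rw [weightedHerm, mul_sum]
    refine sum_congr rfl fun j _ => ?_
    have := hac j
    simp only [x, map_div₀, map_mul, Complex.conj_I, map_natCast, Complex.ofReal_natCast]
    field_simp
  have hy : ∀ v, weightedHerm (fun j => (a j : ℝ)) y v =
      ∑ j, a j * z j ^ (a j - 1) * v j := fun v => by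
    simp [weightedHerm, y, mul_assoc]
  have hmem : ∀ v, v ∈ HN ↔ (weightedHerm (fun j => (a j : ℝ)) z v).im = 0 ∧
      (weightedHerm (fun j => (a j : ℝ)) x v).im = 0 ∧
      weightedHerm (fun j => (a j : ℝ)) y v = 0 := fun v => by
    rw [hHN, sphAlpha_eq_im_weightedHerm, fderiv_sphF_apply, fderiv_re_brG_apply,
      fderiv_im_brG_apply, hx, hy, Complex.ext_iff (z := ∑ j, _)]
    simp
  have hxz : weightedHerm (fun j => (a j : ℝ)) x z = -Complex.I := by
    have : ∑ j, conj (z j) * z j = 1 := by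
      simp only [← Complex.normSq_eq_conj_mul_self]
      exact_mod_cast hz1
    rw [hx, this, mul_one]
  have hyx : weightedHerm (fun j => (a j : ℝ)) y x = 0 := by
    rw [hy, ← mul_zero Complex.I, ← hz2, brG, mul_sum]
    refine sum_congr rfl fun j _ => ?_
    have := hac j
    rw [← pow_sub_one_mul (ha j).ne' (z j)]
    simp only [x]
    field_simp
  have hy0 : y ≠ 0 := fun h => by
    have hz : z = 0 := funext fun j => by
      simpa using eq_zero_of_pow_eq_zero (congrFun h j)
    simp [hz, sphF] at hz1
  intro v hv hv0
  obtain ⟨hzv, hxv, hyv⟩ := (hmem v).mp hv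
  obtain ⟨w, hzw, hxw, hyw, hvw⟩ := exists_im_weightedHerm_ne_zero ha' hxz hyx hy0 hv0 hzv hxv hyv
  refine ⟨w, (hmem w).mpr ⟨hzw, hxw, hyw⟩, ?_⟩
  rw [sphOmega_eq_im_weightedHerm]
  exact mul_ne_zero (by norm_num) hvw
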